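/- arXiv:1704.05022 — 2 statements merged into one kernel-verified Lean document; each statement's English description precedes it below -/
import Mathlib

section
/- Values of Bagderina's fourth-order quantities in special coordinates (formulas (5.32)): assuming A ≡ 0 and G ≡ 0 identically, B(x,y) ≠ 0 and F(x,y) ≠ 0 for all (x,y), the following identities hold on ℝ²: δ₁₀ = F⁵B_x/B³ − 5F⁴F_x/B², δ₂₀ = 5B_x²/(9B) + 2F⁵B_y/B³ − 5F⁴F_y/B² + 2F⁵R/B², δ₃₀ = (2/3)B_xy − B·R_x + (2/3)B_x·R + 2F⁵S/B², δ₁₁ = 20B_x²/(9B) + 11F⁵B_y/B³ − 20F⁴F_y/B² + 8F⁵R/B², δ₂₁ = (8/3)B_xy − B_yB_x/B − 4B·R_x + (5/3)B_x·R + 5F⁵S/B², and δ₃₁ = B_yy + 6B·R_y − 5B·S_x + 12B·R² + 3B_y·R − 5B_x·S. -/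
open Function

noncomputable section

/-- Partial derivative in the first variable. -/
def pdx (f : ℝ → ℝ → ℝ) : ℝ → ℝ → ℝ := fun x y => deriv (fun t => f t y) x

/-- Partial derivative in the second variable. -/
def pdy (f : ℝ → ℝ → ℝ) : ℝ → ℝ → ℝ := fun x y => deriv (fun t => f x t) y

def al0 (P Q R S : ℝ → ℝ → ℝ) : ℝ → ℝ → ℝ := fun x y =>
  pdx Q x y - pdy P x y + 2 * P x y * R x y - 2 * Q x y ^ 2

def al1 (P Q R S : ℝ → ℝ → ℝ) : ℝ → ℝ → ℝ := fun x y =>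
  pdx R x y - pdy Q x y + P x y * S x y - Q x y * R x y

def al2 (P Q R S : ℝ → ℝ → ℝ) : ℝ → ℝ → ℝ := fun x y =>
  pdx S x y - pdy R x y + 2 * Q x y * S x y - 2 * R x y ^ 2

def b1 (P Q R S : ℝ → ℝ → ℝ) : ℝ → ℝ → ℝ := fun x y =>
  pdx (al1 P Q R S) x y - pdy (al0 P Q R S) x y + R x y * al0 P Q R S x y - 2 * Q x y * al1 P Q R S x y + P x y * al2 P Q R S x y

def b2 (P Q R S : ℝ → ℝ → ℝ) : ℝ → ℝ → ℝ := fun x y =>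
  pdx (al2 P Q R S) x y - pdy (al1 P Q R S) x y + S x y * al0 P Q R S x y - 2 * R x y * al1 P Q R S x y + Q x y * al2 P Q R S x y

def g10 (P Q R S : ℝ → ℝ → ℝ) : ℝ → ℝ → ℝ := fun x y =>
  pdx (b1 P Q R S) x y - Q x y * b1 P Q R S x y + P x y * b2 P Q R S x y

def g11 (P Q R S : ℝ → ℝ → ℝ) : ℝ → ℝ → ℝ := fun x y =>
  pdx (b2 P Q R S) x y - R x y * b1 P Q R S x y + Q x y * b2 P Q R S x y

def g20 (P Q R S : ℝ → ℝ → ℝ) : ℝ → ℝ → ℝ := fun x y =>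
  pdy (b1 P Q R S) x y - R x y * b1 P Q R S x y + Q x y * b2 P Q R S x y

def g21 (P Q R S : ℝ → ℝ → ℝ) : ℝ → ℝ → ℝ := fun x y =>
  pdy (b2 P Q R S) x y - S x y * b1 P Q R S x y + R x y * b2 P Q R S x y

def J0 (P Q R S : ℝ → ℝ → ℝ) : ℝ → ℝ → ℝ := fun x y =>
  b2 P Q R S x y ^ 2 * g10 P Q R S x y - b1 P Q R S x y * b2 P Q R S x y * (g20 P Q R S x y + g11 P Q R S x y) + b1 P Q R S x y ^ 2 * g21 P Q R S x y

def Gam0 (P Q R S : ℝ → ℝ → ℝ) : ℝ → ℝ → ℝ := fun x y =>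
  3 * b2 P Q R S x y * g10 P Q R S x y + b1 P Q R S x y * (g20 P Q R S x y - 4 * g11 P Q R S x y)

def Gam1 (P Q R S : ℝ → ℝ → ℝ) : ℝ → ℝ → ℝ := fun x y =>
  b2 P Q R S x y * (4 * g20 P Q R S x y - g11 P Q R S x y) - 3 * b1 P Q R S x y * g21 P Q R S x y

def d10 (P Q R S : ℝ → ℝ → ℝ) : ℝ → ℝ → ℝ := fun x y =>
  pdx (g10 P Q R S) x y - 2 * Q x y * g10 P Q R S x y + P x y * (g20 P Q R S x y + g11 P Q R S x y) - 5 * al0 P Q R S x y * b1 P Q R S x y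

def d20 (P Q R S : ℝ → ℝ → ℝ) : ℝ → ℝ → ℝ := fun x y =>
  pdx (g20 P Q R S) x y - R x y * g10 P Q R S x y + P x y * g21 P Q R S x y - 4 * al1 P Q R S x y * b1 P Q R S x y - al0 P Q R S x y * b2 P Q R S x y

def d30 (P Q R S : ℝ → ℝ → ℝ) : ℝ → ℝ → ℝ := fun x y =>
  pdy (g20 P Q R S) x y - S x y * g10 P Q R S x y + Q x y * g21 P Q R S x y - 4 * al2 P Q R S x y * b1 P Q R S x y - al1 P Q R S x y * b2 P Q R S x y

def d11 (P Q R S : ℝ → ℝ → ℝ) : ℝ → ℝ → ℝ := fun x y =>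
  pdx (g11 P Q R S) x y - R x y * g10 P Q R S x y + P x y * g21 P Q R S x y - al1 P Q R S x y * b1 P Q R S x y - 4 * al0 P Q R S x y * b2 P Q R S x y

def d21 (P Q R S : ℝ → ℝ → ℝ) : ℝ → ℝ → ℝ := fun x y =>
  pdx (g21 P Q R S) x y - R x y * (g20 P Q R S x y + g11 P Q R S x y) + 2 * Q x y * g21 P Q R S x y - 5 * al1 P Q R S x y * b2 P Q R S x y

def d31 (P Q R S : ℝ → ℝ → ℝ) : ℝ → ℝ → ℝ := fun x y =>
  pdy (g21 P Q R S) x y - S x y * (g20 P Q R S x y + g11 P Q R S x y) + 2 * R x y * g21 P Q R S x y - 5 * al2 P Q R S x y * b2 P Q R S x y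

def J1 (P Q R S : ℝ → ℝ → ℝ) : ℝ → ℝ → ℝ := fun x y =>
  b2 P Q R S x y * (d20 P Q R S x y - d11 P Q R S x y) + b1 P Q R S x y * (d21 P Q R S x y - d30 P Q R S x y) + (7 / 5) * (g20 P Q R S x y - g11 P Q R S x y) ^ 2 + (3 / 5) * (g20 P Q R S x y * g11 P Q R S x y - g10 P Q R S x y * g21 P Q R S x y)

def J2 (P Q R S : ℝ → ℝ → ℝ) : ℝ → ℝ → ℝ := fun x y =>
  Gam1 P Q R S x y * (d20 P Q R S x y - d11 P Q R S x y) + Gam0 P Q R S x y * (d21 P Q R S x y - d30 P Q R S x y) + 3 * (g20 P Q R S x y - g11 P Q R S x y) * (g10 P Q R S x y * g21 P Q R S x y - g20 P Q R S x y * g11 P Q R S x y) + (4 / 3) * (g20 P Q R S x y - g11 P Q R S x y) ^ 3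

def J3 (P Q R S : ℝ → ℝ → ℝ) : ℝ → ℝ → ℝ := fun x y =>
  b2 P Q R S x y ^ 3 * d10 P Q R S x y - b1 P Q R S x y * b2 P Q R S x y ^ 2 * (2 * d20 P Q R S x y + d11 P Q R S x y) + b1 P Q R S x y ^ 2 * b2 P Q R S x y * (d30 P Q R S x y + 2 * d21 P Q R S x y) - b1 P Q R S x y ^ 3 * d31 P Q R S x y + 4 * (g20 P Q R S x y - g11 P Q R S x y) * J0 P Q R S x y

def J4 (P Q R S : ℝ → ℝ → ℝ) : ℝ → ℝ → ℝ := fun x y =>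
  -b2 P Q R S x y * (b2 P Q R S x y * Gam0 P Q R S x y + 2 * b1 P Q R S x y * Gam1 P Q R S x y) * (2 * d20 P Q R S x y + d11 P Q R S x y) + b1 P Q R S x y * (2 * b2 P Q R S x y * Gam0 P Q R S x y + b1 P Q R S x y * Gam1 P Q R S x y) * (d30 P Q R S x y + 2 * d21 P Q R S x y) + 3 * b2 P Q R S x y ^ 2 * Gam1 P Q R S x y * d10 P Q R S x y - 3 * b1 P Q R S x y ^ 2 * Gam0 P Q R S x y * d31 P Q R S x y + (66 / 5) * (g20 P Q R S x y - g11 P Q R S x y) ^ 2 * J0 P Q R S x y + (36 / 5) * (g10 P Q R S x y * g21 P Q R S x y - g20 P Q R S x y * g11 P Q R S x y) * J0 P Q R S x y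

def AA (P Q R S : ℝ → ℝ → ℝ) : ℝ → ℝ → ℝ := fun x y =>
  pdy (pdy P) x y - 2 * pdx (pdy Q) x y + pdx (pdx R) x y + 2 * P x y * pdx S x y + S x y * pdx P x y - 3 * P x y * pdy R x y - 3 * R x y * pdy P x y - 3 * Q x y * pdx R x y + 6 * Q x y * pdy Q x y

def BB (P Q R S : ℝ → ℝ → ℝ) : ℝ → ℝ → ℝ := fun x y =>
  pdx (pdx S) x y - 2 * pdx (pdy R) x y + pdy (pdy Q) x y - 2 * S x y * pdy P x y - P x y * pdy S x y + 3 * S x y * pdx Q x y + 3 * Q x y * pdx S x y + 3 * R x y * pdy Q x y - 6 * R x y * pdx R x y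

def GG (P Q R S : ℝ → ℝ → ℝ) : ℝ → ℝ → ℝ := fun x y =>
  -BB P Q R S x y * pdx (BB P Q R S) x y - 3 * AA P Q R S x y * pdy (BB P Q R S) x y + 4 * BB P Q R S x y * pdy (AA P Q R S) x y + 3 * S x y * AA P Q R S x y ^ 2 - 6 * R x y * AA P Q R S x y * BB P Q R S x y + 3 * Q x y * BB P Q R S x y ^ 2

def HH (P Q R S : ℝ → ℝ → ℝ) : ℝ → ℝ → ℝ := fun x y =>
  -AA P Q R S x y * pdy (AA P Q R S) x y - 3 * BB P Q R S x y * pdx (AA P Q R S) x y + 4 * AA P Q R S x y * pdx (BB P Q R S) x y - 3 * P x y * BB P Q R S x y ^ 2 + 6 * Q x y * AA P Q R S x y * BB P Q R S x y - 3 * R x y * AA P Q R S x y ^ 2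

def Phi (P Q R S : ℝ → ℝ → ℝ) : ℝ → ℝ → ℝ := fun x y =>
  AA P Q R S x y * BB P Q R S x y * pdy (AA P Q R S) x y + AA P Q R S x y * BB P Q R S x y * pdx (BB P Q R S) x y - AA P Q R S x y ^ 2 * pdy (BB P Q R S) x y - BB P Q R S x y ^ 2 * pdx (AA P Q R S) x y - P x y * BB P Q R S x y ^ 3 + 3 * Q x y * AA P Q R S x y * BB P Q R S x y ^ 2 - 3 * R x y * AA P Q R S x y ^ 2 * BB P Q R S x y + S x y * AA P Q R S x y ^ 3

def I3v (P Q R S F : ℝ → ℝ → ℝ) : ℝ → ℝ → ℝ := fun x y =>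
  BB P Q R S x y * (HH P Q R S x y * pdx (GG P Q R S) x y - GG P Q R S x y * pdx (HH P Q R S) x y) / (3 * F x y ^ 9) - AA P Q R S x y * (HH P Q R S x y * pdy (GG P Q R S) x y - GG P Q R S x y * pdy (HH P Q R S) x y) / (3 * F x y ^ 9) + (HH P Q R S x y * pdy F x y + GG P Q R S x y * pdx F x y) / (3 * F x y ^ 5) + BB P Q R S x y * GG P Q R S x y ^ 2 * P x y / (3 * F x y ^ 9) - (AA P Q R S x y * GG P Q R S x y ^ 2 - 2 * HH P Q R S x y * BB P Q R S x y * GG P Q R S x y) * Q x y / (3 * F x y ^ 9) + (BB P Q R S x y * HH P Q R S x y ^ 2 - 2 * HH P Q R S x y * AA P Q R S x y * GG P Q R S x y) * R x y / (3 * F x y ^ 9) - AA P Q R S x y * HH P Q R S x y ^ 2 * S x y / (3 * F x y ^ 9)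

def I6v (P Q R S F : ℝ → ℝ → ℝ) : ℝ → ℝ → ℝ := fun x y =>
  (pdy (AA P Q R S) x y - pdx (BB P Q R S) x y) / (3 * F x y ^ 2) - (AA P Q R S x y * pdy F x y - BB P Q R S x y * pdx F x y) / (3 * F x y ^ 3)

def I7v (P Q R S F : ℝ → ℝ → ℝ) : ℝ → ℝ → ℝ := fun x y =>
  (GG P Q R S x y * HH P Q R S x y * pdx (GG P Q R S) x y - GG P Q R S x y ^ 2 * pdx (HH P Q R S) x y + HH P Q R S x y ^ 2 * pdy (GG P Q R S) x y - HH P Q R S x y * GG P Q R S x y * pdy (HH P Q R S) x y) / (3 * F x y ^ 11) + (GG P Q R S x y ^ 3 * P x y + 3 * GG P Q R S x y ^ 2 * HH P Q R S x y * Q x y + 3 * GG P Q R S x y * HH P Q R S x y ^ 2 * R x y + HH P Q R S x y ^ 3 * S x y) / (3 * F x y ^ 11)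

def I8v (P Q R S F : ℝ → ℝ → ℝ) : ℝ → ℝ → ℝ := fun x y =>
  GG P Q R S x y * (AA P Q R S x y * pdx (GG P Q R S) x y + BB P Q R S x y * pdx (HH P Q R S) x y) / (3 * F x y ^ 9) + HH P Q R S x y * (AA P Q R S x y * pdy (GG P Q R S) x y + BB P Q R S x y * pdy (HH P Q R S) x y) / (3 * F x y ^ 9) - 10 * (HH P Q R S x y * pdy F x y + GG P Q R S x y * pdx F x y) / (3 * F x y ^ 5) - BB P Q R S x y * GG P Q R S x y ^ 2 * P x y / (3 * F x y ^ 9) + (AA P Q R S x y * GG P Q R S x y ^ 2 - 2 * HH P Q R S x y * BB P Q R S x y * GG P Q R S x y) * Q x y / (3 * F x y ^ 9) - (BB P Q R S x y * HH P Q R S x y ^ 2 - 2 * HH P Q R S x y * AA P Q R S x y * GG P Q R S x y) * R x y / (3 * F x y ^ 9) + AA P Q R S x y * HH P Q R S x y ^ 2 * S x y / (3 * F x y ^ 9)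

def XX (P Q R S F f : ℝ → ℝ → ℝ) : ℝ → ℝ → ℝ := fun x y =>
  (BB P Q R S x y * pdx f x y - AA P Q R S x y * pdy f x y) / F x y ^ 2

def YY (P Q R S F f : ℝ → ℝ → ℝ) : ℝ → ℝ → ℝ := fun x y =>
  (GG P Q R S x y * pdx f x y + HH P Q R S x y * pdy f x y) / F x y ^ 4

def IBgd1 (P Q R S F : ℝ → ℝ → ℝ) : ℝ → ℝ → ℝ := fun x y =>
  J1 P Q R S x y / F x y ^ 4

def IBgd2 (P Q R S F : ℝ → ℝ → ℝ) : ℝ → ℝ → ℝ := fun x y =>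
  J2 P Q R S x y / F x y ^ 6

def IBgd3 (P Q R S F : ℝ → ℝ → ℝ) : ℝ → ℝ → ℝ := fun x y =>
  -(J3 P Q R S x y / F x y ^ 7)

def IBgd4 (P Q R S F : ℝ → ℝ → ℝ) : ℝ → ℝ → ℝ := fun x y =>
  -(J4 P Q R S x y / F x y ^ 9)


namespace ContDiff

variable {f : ℝ → ℝ → ℝ}

theorem hasDerivAt_pdx (hf : ContDiff ℝ (⊤ : ℕ∞) (uncurry f)) (x y : ℝ) :
    HasDerivAt (fun t => f t y) (pdx f x y) x := by
  have h : ContDiff ℝ (⊤ : ℕ∞) (fun t : ℝ => uncurry f (t, y)) :=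
    hf.comp (contDiff_id.prodMk contDiff_const)
  exact ((h.differentiable (by simp)) x).hasDerivAt

theorem hasDerivAt_pdy (hf : ContDiff ℝ (⊤ : ℕ∞) (uncurry f)) (x y : ℝ) :
    HasDerivAt (fun t => f x t) (pdy f x y) y := by
  have h : ContDiff ℝ (⊤ : ℕ∞) (fun t : ℝ => uncurry f (x, t)) :=
    hf.comp (contDiff_const.prodMk contDiff_id)
  exact ((h.differentiable (by simp)) y).hasDerivAt

theorem pdx_eq_fderiv (hf : ContDiff ℝ (⊤ : ℕ∞) (uncurry f)) (x y : ℝ) :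
    pdx f x y = fderiv ℝ (uncurry f) (x, y) (1, 0) := by
  have h := ((hf.differentiable (by simp)) (x, y)).hasFDerivAt.comp_hasDerivAt x
    ((hasDerivAt_id x).prodMk (hasDerivAt_const x y))
  exact h.deriv

theorem pdy_eq_fderiv (hf : ContDiff ℝ (⊤ : ℕ∞) (uncurry f)) (x y : ℝ) :
    pdy f x y = fderiv ℝ (uncurry f) (x, y) (0, 1) := by
  have h := ((hf.differentiable (by simp)) (x, y)).hasFDerivAt.comp_hasDerivAt y
    ((hasDerivAt_const y x).prodMk (hasDerivAt_id y))
  exact h.deriv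

theorem uncurry_pdx (hf : ContDiff ℝ (⊤ : ℕ∞) (uncurry f)) :
    ContDiff ℝ (⊤ : ℕ∞) (uncurry (pdx f)) := by
  have h : uncurry (pdx f) = fun p => fderiv ℝ (uncurry f) p (1, 0) :=
    funext fun p => hf.pdx_eq_fderiv p.1 p.2
  rw [h]
  exact (hf.fderiv_right (by simp)).clm_apply contDiff_const

theorem uncurry_pdy (hf : ContDiff ℝ (⊤ : ℕ∞) (uncurry f)) :
    ContDiff ℝ (⊤ : ℕ∞) (uncurry (pdy f)) := by
  have h : uncurry (pdy f) = fun p => fderiv ℝ (uncurry f) p (0, 1) :=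
    funext fun p => hf.pdy_eq_fderiv p.1 p.2
  rw [h]
  exact (hf.fderiv_right (by simp)).clm_apply contDiff_const

/-- Mixed partial derivatives of a smooth function commute. -/
theorem pdy_pdx_eq_pdx_pdy (hf : ContDiff ℝ (⊤ : ℕ∞) (uncurry f)) (x y : ℝ) :
    pdy (pdx f) x y = pdx (pdy f) x y := by
  have hx : uncurry (pdx f) = fun p => fderiv ℝ (uncurry f) p (1, 0) :=
    funext fun p => hf.pdx_eq_fderiv p.1 p.2
  have hy : uncurry (pdy f) = fun p => fderiv ℝ (uncurry f) p (0, 1) :=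
    funext fun p => hf.pdy_eq_fderiv p.1 p.2
  have hd : DifferentiableAt ℝ (fderiv ℝ (uncurry f)) (x, y) :=
    (hf.fderiv_right (m := (⊤ : ℕ∞)) (by simp)).differentiable (by simp) (x, y)
  have hsymm : IsSymmSndFDerivAt ℝ (uncurry f) (x, y) :=
    hf.contDiffAt.isSymmSndFDerivAt (by
      rw [minSmoothness_of_isRCLikeNormedField]
      exact WithTop.coe_le_coe.2 (le_top : (2 : ℕ∞) ≤ ⊤))
  rw [hf.uncurry_pdx.pdy_eq_fderiv, hf.uncurry_pdy.pdx_eq_fderiv, hx, hy,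
    fderiv_clm_apply hd (differentiableAt_const _), fderiv_clm_apply hd (differentiableAt_const _)]
  simpa using hsymm (0, 1) (1, 0)

end ContDiff

variable {P Q R S : ℝ → ℝ → ℝ}

theorem b1_eq_AA (hP : ContDiff ℝ (⊤ : ℕ∞) (uncurry P)) (hQ : ContDiff ℝ (⊤ : ℕ∞) (uncurry Q))
    (hR : ContDiff ℝ (⊤ : ℕ∞) (uncurry R)) (hS : ContDiff ℝ (⊤ : ℕ∞) (uncurry S)) :
    b1 P Q R S = AA P Q R S := by
  funext x y
  have h1 : pdx (al1 P Q R S) x y = _ :=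
    ((((hR.uncurry_pdx.hasDerivAt_pdx x y).sub (hQ.uncurry_pdy.hasDerivAt_pdx x y)).add
      ((hP.hasDerivAt_pdx x y).mul (hS.hasDerivAt_pdx x y))).sub
      ((hQ.hasDerivAt_pdx x y).mul (hR.hasDerivAt_pdx x y))).deriv
  have h0 : pdy (al0 P Q R S) x y = _ :=
    ((((hQ.uncurry_pdx.hasDerivAt_pdy x y).sub (hP.uncurry_pdy.hasDerivAt_pdy x y)).add
      (((hP.hasDerivAt_pdy x y).const_mul 2).mul (hR.hasDerivAt_pdy x y))).sub
      (((hQ.hasDerivAt_pdy x y).pow 2).const_mul 2)).deriv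
  simp only [b1, AA, h1, h0, hQ.pdy_pdx_eq_pdx_pdy, al0, al1, al2]
  push_cast
  ring

theorem b2_eq_BB (hP : ContDiff ℝ (⊤ : ℕ∞) (uncurry P)) (hQ : ContDiff ℝ (⊤ : ℕ∞) (uncurry Q))
    (hR : ContDiff ℝ (⊤ : ℕ∞) (uncurry R)) (hS : ContDiff ℝ (⊤ : ℕ∞) (uncurry S)) :
    b2 P Q R S = BB P Q R S := by
  funext x y
  have h2 : pdx (al2 P Q R S) x y = _ :=
    ((((hS.uncurry_pdx.hasDerivAt_pdx x y).sub (hR.uncurry_pdy.hasDerivAt_pdx x y)).add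
      (((hQ.hasDerivAt_pdx x y).const_mul 2).mul (hS.hasDerivAt_pdx x y))).sub
      (((hR.hasDerivAt_pdx x y).pow 2).const_mul 2)).deriv
  have h1 : pdy (al1 P Q R S) x y = _ :=
    ((((hR.uncurry_pdx.hasDerivAt_pdy x y).sub (hQ.uncurry_pdy.hasDerivAt_pdy x y)).add
      ((hP.hasDerivAt_pdy x y).mul (hS.hasDerivAt_pdy x y))).sub
      ((hQ.hasDerivAt_pdy x y).mul (hR.hasDerivAt_pdy x y))).deriv
  simp only [b2, BB, h1, h2, hR.pdy_pdx_eq_pdx_pdy, al0, al1, al2]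
  push_cast
  ring

theorem contDiff_uncurry_BB (hP : ContDiff ℝ (⊤ : ℕ∞) (uncurry P))
    (hQ : ContDiff ℝ (⊤ : ℕ∞) (uncurry Q)) (hR : ContDiff ℝ (⊤ : ℕ∞) (uncurry R))
    (hS : ContDiff ℝ (⊤ : ℕ∞) (uncurry S)) : ContDiff ℝ (⊤ : ℕ∞) (uncurry (BB P Q R S)) :=
  ((((((((hS.uncurry_pdx.uncurry_pdx.sub (contDiff_const.mul hR.uncurry_pdy.uncurry_pdx)).add
    hQ.uncurry_pdy.uncurry_pdy).sub ((contDiff_const.mul hS).mul hP.uncurry_pdy)).sub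
    (hP.mul hS.uncurry_pdy)).add ((contDiff_const.mul hS).mul hQ.uncurry_pdx)).add
    ((contDiff_const.mul hQ).mul hS.uncurry_pdx)).add
    ((contDiff_const.mul hR).mul hQ.uncurry_pdy)).sub
    ((contDiff_const.mul hR).mul hR.uncurry_pdx))

theorem stmt16 (P Q R S : ℝ → ℝ → ℝ)
    (hP : ContDiff ℝ (⊤ : ℕ∞) (uncurry P)) (hQ : ContDiff ℝ (⊤ : ℕ∞) (uncurry Q))
    (hR : ContDiff ℝ (⊤ : ℕ∞) (uncurry R)) (hS : ContDiff ℝ (⊤ : ℕ∞) (uncurry S)) (F : ℝ → ℝ → ℝ)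
    (hF : ContDiff ℝ (⊤ : ℕ∞) (uncurry F)) (hF5 : ∀ x y : ℝ, F x y ^ 5 = Phi P Q R S x y) (hFne : ∀ x y : ℝ, F x y ≠ 0) (hA : ∀ x y : ℝ, AA P Q R S x y = 0) (hG : ∀ x y : ℝ, GG P Q R S x y = 0)
    (hB : ∀ x y : ℝ, BB P Q R S x y ≠ 0) :
    ∀ x y : ℝ,
      d10 P Q R S x y = F x y ^ 5 * pdx (BB P Q R S) x y / BB P Q R S x y ^ 3 - 5 * F x y ^ 4 * pdx F x y / BB P Q R S x y ^ 2 ∧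
      d20 P Q R S x y = 5 * pdx (BB P Q R S) x y ^ 2 / (9 * BB P Q R S x y) + 2 * F x y ^ 5 * pdy (BB P Q R S) x y / BB P Q R S x y ^ 3
        - 5 * F x y ^ 4 * pdy F x y / BB P Q R S x y ^ 2 + 2 * F x y ^ 5 * R x y / BB P Q R S x y ^ 2 ∧
      d30 P Q R S x y = (2 / 3) * pdx (pdy (BB P Q R S)) x y - BB P Q R S x y * pdx R x y + (2 / 3) * pdx (BB P Q R S) x y * R x y
        + 2 * F x y ^ 5 * S x y / BB P Q R S x y ^ 2 ∧
      d11 P Q R S x y = 20 * pdx (BB P Q R S) x y ^ 2 / (9 * BB P Q R S x y) + 11 * F x y ^ 5 * pdy (BB P Q R S) x y / BB P Q R S x y ^ 3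
        - 20 * F x y ^ 4 * pdy F x y / BB P Q R S x y ^ 2 + 8 * F x y ^ 5 * R x y / BB P Q R S x y ^ 2 ∧
      d21 P Q R S x y = (8 / 3) * pdx (pdy (BB P Q R S)) x y - pdy (BB P Q R S) x y * pdx (BB P Q R S) x y / BB P Q R S x y - 4 * BB P Q R S x y * pdx R x y
        + (5 / 3) * pdx (BB P Q R S) x y * R x y + 5 * F x y ^ 5 * S x y / BB P Q R S x y ^ 2 ∧
      d31 P Q R S x y = pdy (pdy (BB P Q R S)) x y + 6 * BB P Q R S x y * pdy R x y - 5 * BB P Q R S x y * pdx S x y + 12 * BB P Q R S x y * R x y ^ 2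
        + 3 * pdy (BB P Q R S) x y * R x y - 5 * pdx (BB P Q R S) x y * S x y := by
  have e1 : b1 P Q R S = fun _ _ => 0 := by
    rw [b1_eq_AA hP hQ hR hS]
    exact funext₂ hA
  have e2 := b2_eq_BB hP hQ hR hS
  have hBs := contDiff_uncurry_BB hP hQ hR hS
  have hA' : AA P Q R S = fun _ _ => 0 := funext₂ hA
  have hx0 : ∀ x y : ℝ, pdx (fun _ _ => (0 : ℝ)) x y = 0 := fun x y => by simp [pdx]
  have hy0 : ∀ x y : ℝ, pdy (fun _ _ => (0 : ℝ)) x y = 0 := fun x y => by simp [pdy]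
  simp only [GG, hA', hy0] at hG
  simp only [Phi, hA', hx0, hy0] at hF5
  generalize BB P Q R S = B at *
  have hBx : ∀ x y, pdx B x y = 3 * Q x y * B x y := fun x y =>
    mul_left_cancel₀ (hB x y) (by linear_combination -hG x y)
  have hF5' : ∀ x y, F x y ^ 5 = -(P x y * B x y ^ 3) := fun x y => by
    linear_combination hF5 x y
  have e10 : g10 P Q R S = fun x y => P x y * B x y := by
    funext x y; simp only [g10, e1, e2, hx0]; ring
  have e11 : g11 P Q R S = fun x y => 4 * Q x y * B x y := by
    funext x y; simp only [g11, e1, e2, hBx]; ring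
  have e20 : g20 P Q R S = fun x y => Q x y * B x y := by
    funext x y; simp only [g20, e1, e2, hy0]; ring
  have e21 : g21 P Q R S = fun x y => pdy B x y + R x y * B x y := by
    funext x y; simp only [g21, e1, e2]; ring
  intro x y
  have hb := hB x y
  have hFx : 5 * F x y ^ 4 * pdx F x y
      = -(pdx P x y * B x y ^ 3 + 3 * P x y * B x y ^ 2 * pdx B x y) := by
    have h := ((hF.hasDerivAt_pdx x y).pow 5).unique
      (((hP.hasDerivAt_pdx x y).mul ((hBs.hasDerivAt_pdx x y).pow 3)).neg.congr_of_eventuallyEq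
        (.of_forall fun t => hF5' t y))
    simp only [Pi.pow_apply] at h
    push_cast at h
    linear_combination h
  have hFy : 5 * F x y ^ 4 * pdy F x y
      = -(pdy P x y * B x y ^ 3 + 3 * P x y * B x y ^ 2 * pdy B x y) := by
    have h := ((hF.hasDerivAt_pdy x y).pow 5).unique
      (((hP.hasDerivAt_pdy x y).mul ((hBs.hasDerivAt_pdy x y).pow 3)).neg.congr_of_eventuallyEq
        (.of_forall fun t => hF5' x t))
    simp only [Pi.pow_apply] at h
    push_cast at h
    linear_combination h
  have hBxy : pdx (pdy B) x y = 3 * (pdy Q x y * B x y + Q x y * pdy B x y) := by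
    rw [← hBs.pdy_pdx_eq_pdx_pdy]
    have h := (hBs.uncurry_pdx.hasDerivAt_pdy x y).unique
      ((((hQ.hasDerivAt_pdy x y).const_mul 3).mul
        (hBs.hasDerivAt_pdy x y)).congr_of_eventuallyEq (.of_forall fun t => hBx x t))
    linear_combination h
  have k10 : pdx (fun x y => P x y * B x y) x y = _ :=
    ((hP.hasDerivAt_pdx x y).mul (hBs.hasDerivAt_pdx x y)).deriv
  have k11 : pdx (fun x y => 4 * Q x y * B x y) x y = _ :=
    (((hQ.hasDerivAt_pdx x y).const_mul 4).mul (hBs.hasDerivAt_pdx x y)).deriv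
  have k20x : pdx (fun x y => Q x y * B x y) x y = _ :=
    ((hQ.hasDerivAt_pdx x y).mul (hBs.hasDerivAt_pdx x y)).deriv
  have k20y : pdy (fun x y => Q x y * B x y) x y = _ :=
    ((hQ.hasDerivAt_pdy x y).mul (hBs.hasDerivAt_pdy x y)).deriv
  have k21x : pdx (fun x y => pdy B x y + R x y * B x y) x y = _ :=
    ((hBs.uncurry_pdy.hasDerivAt_pdx x y).add
      ((hR.hasDerivAt_pdx x y).mul (hBs.hasDerivAt_pdx x y))).deriv
  have k21y : pdy (fun x y => pdy B x y + R x y * B x y) x y = _ :=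
    ((hBs.uncurry_pdy.hasDerivAt_pdy x y).add
      ((hR.hasDerivAt_pdy x y).mul (hBs.hasDerivAt_pdy x y))).deriv
  have hF2 : F x y ^ 5 / B x y ^ 2 = -(P x y * B x y) := by
    rw [hF5']; field_simp
  have hF3 : F x y ^ 5 / B x y ^ 3 = -P x y := by
    rw [hF5']; field_simp
  have hFx2 : 5 * F x y ^ 4 * pdx F x y / B x y ^ 2
      = -(pdx P x y * B x y + 9 * P x y * Q x y * B x y) := by
    rw [hFx, hBx]; field_simp; ring
  have hFy2 : 5 * F x y ^ 4 * pdy F x y / B x y ^ 2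
      = -(pdy P x y * B x y + 3 * P x y * pdy B x y) := by
    rw [hFy]; field_simp
  have hBx2 : pdx B x y ^ 2 / B x y = 9 * Q x y ^ 2 * B x y := by
    rw [hBx]; field_simp; ring
  have hBxB : pdx B x y / B x y = 3 * Q x y := by
    rw [hBx]; field_simp
  simp only [d10, d20, d30, d11, d21, d31, e10, e11, e20, e21, k10, k11, k20x, k20y, k21x, k21y,
    e1, e2, al0, al1, al2]
  refine ⟨?_, ?_, ?_, ?_, ?_, ?_⟩
  · linear_combination hFx2 - pdx B x y * hF3 + 2 * P x y * hBx x y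
  · linear_combination hFy2 - 2 * pdy B x y * hF3 - 2 * R x y * hF2 - 5 / 9 * hBx2 + Q x y * hBx x y
  · linear_combination -2 * S x y * hF2 - 2 / 3 * hBxy - 2 / 3 * R x y * hBx x y
  · linear_combination 4 * hFy2 - 11 * pdy B x y * hF3 - 8 * R x y * hF2
      - 20 / 9 * hBx2 + 4 * Q x y * hBx x y
  · linear_combination -5 * S x y * hF2 - 5 / 3 * hBxy - 2 / 3 * R x y * hBx x y + pdy B x y * hBxB
  · linear_combination 5 * S x y * hBx x y
end
end

section
/- Values of Bagderina's scalar invariants in special coordinates (formulas (5.36)–(5.39)): assuming A ≡ 0 and G ≡ 0 identically, B(x,y) ≠ 0 and F(x,y) ≠ 0 for all (x,y), the following identities hold on ℝ²: J₁ = F⁴·(15F_y/B − 42F·B_y/(5B²) − 27F·R/(5B)), J₂ = F⁶·(−6B_xy/(F·B) + 6B_x·B_y/(F·B²) + 9R_x/F − 9F⁴S/B³), J₃ = −F⁷·(−5B_x/F² + 5B·F_x/F³), and J₄ = −F⁹·(90F_y/B − 261F·B_y/(5B²) − 216F·R/(5B)); i.e. Bagderina's invariants I₁^Bgd = J₁/F⁴,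 I₂^Bgd = J₂/F⁶, I₃^Bgd = −J₃/F⁷, I₄^Bgd = −J₄/F⁹ take the displayed values. -/
open Function

noncomputable section

theorem ContDiff.hasDerivAt_pdx_s17 {f : ℝ → ℝ → ℝ} (hf : ContDiff ℝ (⊤ : ℕ∞) (uncurry f))
    (x y : ℝ) : HasDerivAt (fun t => f t y) (pdx f x y) x := by
  have h : ContDiff ℝ (⊤ : ℕ∞) (fun t => f t y) :=
    hf.comp (contDiff_id.prodMk contDiff_const)
  exact (h.differentiable (by simp) x).hasDerivAt

theorem ContDiff.hasDerivAt_pdy_s17 {f : ℝ → ℝ → ℝ} (hf : ContDiff ℝ (⊤ : ℕ∞) (uncurry f))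
    (x y : ℝ) : HasDerivAt (fun t => f x t) (pdy f x y) y := by
  have h : ContDiff ℝ (⊤ : ℕ∞) (fun t => f x t) :=
    hf.comp (contDiff_const.prodMk contDiff_id)
  exact (h.differentiable (by simp) y).hasDerivAt

theorem ContDiff.pdx_eq_fderiv_s17 {f : ℝ → ℝ → ℝ} (hf : ContDiff ℝ (⊤ : ℕ∞) (uncurry f))
    (x y : ℝ) : pdx f x y = fderiv ℝ (uncurry f) (x, y) (1, 0) := by
  have h := (hf.differentiable (by simp) (x, y)).hasFDerivAt
  exact (h.comp_hasDerivAt x ((hasDerivAt_id x).prodMk (hasDerivAt_const x y))).deriv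

theorem ContDiff.pdy_eq_fderiv_s17 {f : ℝ → ℝ → ℝ} (hf : ContDiff ℝ (⊤ : ℕ∞) (uncurry f))
    (x y : ℝ) : pdy f x y = fderiv ℝ (uncurry f) (x, y) (0, 1) := by
  have h := (hf.differentiable (by simp) (x, y)).hasFDerivAt
  exact (h.comp_hasDerivAt y ((hasDerivAt_const y x).prodMk (hasDerivAt_id y))).deriv

theorem ContDiff.uncurry_pdx_s17 {f : ℝ → ℝ → ℝ} (hf : ContDiff ℝ (⊤ : ℕ∞) (uncurry f)) :
    ContDiff ℝ (⊤ : ℕ∞) (uncurry (pdx f)) := by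
  have h : uncurry (pdx f) = fun p => fderiv ℝ (uncurry f) p (1, 0) := by
    ext ⟨x, y⟩
    exact hf.pdx_eq_fderiv_s17 x y
  rw [h]
  exact (hf.fderiv_right (by simp)).clm_apply contDiff_const

theorem ContDiff.uncurry_pdy_s17 {f : ℝ → ℝ → ℝ} (hf : ContDiff ℝ (⊤ : ℕ∞) (uncurry f)) :
    ContDiff ℝ (⊤ : ℕ∞) (uncurry (pdy f)) := by
  have h : uncurry (pdy f) = fun p => fderiv ℝ (uncurry f) p (0, 1) := by
    ext ⟨x, y⟩
    exact hf.pdy_eq_fderiv_s17 x y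
  rw [h]
  exact (hf.fderiv_right (by simp)).clm_apply contDiff_const

/-- Mixed partial derivatives of a smooth function commute. -/
theorem ContDiff.pdy_pdx {f : ℝ → ℝ → ℝ} (hf : ContDiff ℝ (⊤ : ℕ∞) (uncurry f))
    (x y : ℝ) : pdy (pdx f) x y = pdx (pdy f) x y := by
  have hd := ((hf.fderiv_right (m := (⊤ : ℕ∞)) (by simp)).differentiable (by simp)
    (x, y)).hasFDerivAt
  have hx : pdx f = fun a b => fderiv ℝ (uncurry f) (a, b) (1, 0) := by
    ext a b
    exact hf.pdx_eq_fderiv_s17 a b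
  have hy : pdy f = fun a b => fderiv ℝ (uncurry f) (a, b) (0, 1) := by
    ext a b
    exact hf.pdy_eq_fderiv_s17 a b
  have h1 : pdy (pdx f) x y = fderiv ℝ (fderiv ℝ (uncurry f)) (x, y) (0, 1) (1, 0) := by
    rw [hx]
    have h := hd.comp_hasDerivAt y ((hasDerivAt_const y x).prodMk (hasDerivAt_id y))
    exact (h.clm_apply (hasDerivAt_const y ((1 : ℝ), (0 : ℝ)))).deriv.trans (by simp)
  have h2 : pdx (pdy f) x y = fderiv ℝ (fderiv ℝ (uncurry f)) (x, y) (1, 0) (0, 1) := by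
    rw [hy]
    have h := hd.comp_hasDerivAt x ((hasDerivAt_id x).prodMk (hasDerivAt_const x y))
    exact (h.clm_apply (hasDerivAt_const x ((0 : ℝ), (1 : ℝ)))).deriv.trans (by simp)
  rw [h1, h2]
  exact (hf.contDiffAt.isSymmSndFDerivAt (by
    simpa using WithTop.coe_le_coe.2 (le_top (a := (2 : ℕ∞))))) (0, 1) (1, 0)

section Coefficients

variable {P Q R S : ℝ → ℝ → ℝ}

theorem pdx_al1 (hP : ContDiff ℝ (⊤ : ℕ∞) (uncurry P)) (hQ : ContDiff ℝ (⊤ : ℕ∞) (uncurry Q))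
    (hR : ContDiff ℝ (⊤ : ℕ∞) (uncurry R)) (hS : ContDiff ℝ (⊤ : ℕ∞) (uncurry S)) (x y : ℝ) :
    pdx (al1 P Q R S) x y = pdx (pdx R) x y - pdx (pdy Q) x y
      + (pdx P x y * S x y + P x y * pdx S x y)
      - (pdx Q x y * R x y + Q x y * pdx R x y) :=
  (((hR.uncurry_pdx_s17.hasDerivAt_pdx_s17 x y).sub (hQ.uncurry_pdy_s17.hasDerivAt_pdx_s17 x y)).add
    ((hP.hasDerivAt_pdx_s17 x y).mul (hS.hasDerivAt_pdx_s17 x y))).sub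
    ((hQ.hasDerivAt_pdx_s17 x y).mul (hR.hasDerivAt_pdx_s17 x y)) |>.deriv

theorem pdy_al1 (hP : ContDiff ℝ (⊤ : ℕ∞) (uncurry P)) (hQ : ContDiff ℝ (⊤ : ℕ∞) (uncurry Q))
    (hR : ContDiff ℝ (⊤ : ℕ∞) (uncurry R)) (hS : ContDiff ℝ (⊤ : ℕ∞) (uncurry S)) (x y : ℝ) :
    pdy (al1 P Q R S) x y = pdx (pdy R) x y - pdy (pdy Q) x y
      + (pdy P x y * S x y + P x y * pdy S x y)
      - (pdy Q x y * R x y + Q x y * pdy R x y) := by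
  rw [← hR.pdy_pdx]
  exact (((hR.uncurry_pdx_s17.hasDerivAt_pdy_s17 x y).sub (hQ.uncurry_pdy_s17.hasDerivAt_pdy_s17 x y)).add
    ((hP.hasDerivAt_pdy_s17 x y).mul (hS.hasDerivAt_pdy_s17 x y))).sub
    ((hQ.hasDerivAt_pdy_s17 x y).mul (hR.hasDerivAt_pdy_s17 x y)) |>.deriv

theorem pdy_al0 (hP : ContDiff ℝ (⊤ : ℕ∞) (uncurry P)) (hQ : ContDiff ℝ (⊤ : ℕ∞) (uncurry Q))
    (hR : ContDiff ℝ (⊤ : ℕ∞) (uncurry R)) (x y : ℝ) :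
    pdy (al0 P Q R S) x y = pdx (pdy Q) x y - pdy (pdy P) x y
      + 2 * (pdy P x y * R x y + P x y * pdy R x y) - 4 * (Q x y * pdy Q x y) := by
  have h := ((((hQ.uncurry_pdx_s17.hasDerivAt_pdy_s17 x y).sub (hP.uncurry_pdy_s17.hasDerivAt_pdy_s17 x y)).add
    (((hP.hasDerivAt_pdy_s17 x y).const_mul 2).mul (hR.hasDerivAt_pdy_s17 x y))).sub
    (((hQ.hasDerivAt_pdy_s17 x y).pow 2).const_mul 2)).deriv
  rw [← hQ.pdy_pdx]
  refine Eq.trans h ?_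
  push_cast
  ring

theorem pdx_al2 (hQ : ContDiff ℝ (⊤ : ℕ∞) (uncurry Q)) (hR : ContDiff ℝ (⊤ : ℕ∞) (uncurry R))
    (hS : ContDiff ℝ (⊤ : ℕ∞) (uncurry S)) (x y : ℝ) :
    pdx (al2 P Q R S) x y = pdx (pdx S) x y - pdx (pdy R) x y
      + 2 * (pdx Q x y * S x y + Q x y * pdx S x y) - 4 * (R x y * pdx R x y) := by
  have h := ((((hS.uncurry_pdx_s17.hasDerivAt_pdx_s17 x y).sub (hR.uncurry_pdy_s17.hasDerivAt_pdx_s17 x y)).add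
    (((hQ.hasDerivAt_pdx_s17 x y).const_mul 2).mul (hS.hasDerivAt_pdx_s17 x y))).sub
    (((hR.hasDerivAt_pdx_s17 x y).pow 2).const_mul 2)).deriv
  refine Eq.trans h ?_
  push_cast
  ring

end Coefficients

theorem stmt17 (P Q R S : ℝ → ℝ → ℝ)
    (hP : ContDiff ℝ (⊤ : ℕ∞) (uncurry P)) (hQ : ContDiff ℝ (⊤ : ℕ∞) (uncurry Q))
    (hR : ContDiff ℝ (⊤ : ℕ∞) (uncurry R)) (hS : ContDiff ℝ (⊤ : ℕ∞) (uncurry S)) (F : ℝ → ℝ → ℝ)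
    (hF : ContDiff ℝ (⊤ : ℕ∞) (uncurry F)) (hF5 : ∀ x y : ℝ, F x y ^ 5 = Phi P Q R S x y) (hFne : ∀ x y : ℝ, F x y ≠ 0) (hA : ∀ x y : ℝ, AA P Q R S x y = 0) (hG : ∀ x y : ℝ, GG P Q R S x y = 0)
    (hB : ∀ x y : ℝ, BB P Q R S x y ≠ 0) :
    ∀ x y : ℝ,
      J1 P Q R S x y = F x y ^ 4 * (15 * pdy F x y / BB P Q R S x y - 42 * F x y * pdy (BB P Q R S) x y / (5 * BB P Q R S x y ^ 2)
        - 27 * F x y * R x y / (5 * BB P Q R S x y)) ∧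
      J2 P Q R S x y = F x y ^ 6 * (-6 * pdx (pdy (BB P Q R S)) x y / (F x y * BB P Q R S x y) + 6 * pdx (BB P Q R S) x y * pdy (BB P Q R S) x y / (F x y * BB P Q R S x y ^ 2)
        + 9 * pdx R x y / F x y - 9 * F x y ^ 4 * S x y / BB P Q R S x y ^ 3) ∧
      J3 P Q R S x y = -(F x y ^ 7) * (-5 * pdx (BB P Q R S) x y / F x y ^ 2 + 5 * BB P Q R S x y * pdx F x y / F x y ^ 3) ∧
      J4 P Q R S x y = -(F x y ^ 9) * (90 * pdy F x y / BB P Q R S x y - 261 * F x y * pdy (BB P Q R S) x y / (5 * BB P Q R S x y ^ 2)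
        - 216 * F x y * R x y / (5 * BB P Q R S x y)) := by
  have hBs := contDiff_uncurry_BB hP hQ hR hS
  have hb2 := b2_eq_BB hP hQ hR hS
  have hA0 : AA P Q R S = fun _ _ => 0 := by
    ext x y
    exact hA x y
  have hb1 : b1 P Q R S = fun _ _ => 0 := (b1_eq_AA hP hQ hR hS).trans hA0
  have hx0 : pdx (fun _ _ => 0) = fun _ _ => 0 := by
    ext
    simp [pdx]
  have hy0 : pdy (fun _ _ => 0) = fun _ _ => 0 := by
    ext
    simp [pdy]
  have hΦ : ∀ x y, F x y ^ 5 = -(P x y * BB P Q R S x y ^ 3) := by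
    intro x y
    rw [hF5, Phi, hA0, hx0, hy0]
    ring
  have hBx : pdx (BB P Q R S) = fun x y => 3 * Q x y * BB P Q R S x y := by
    ext x y
    have h := hG x y
    rw [GG, hA0, hy0] at h
    apply mul_left_cancel₀ (hB x y)
    linear_combination -h
  have hg10 : g10 P Q R S = fun x y => P x y * BB P Q R S x y := by
    ext x y
    simp only [g10, hb1, hb2, hx0]
    ring
  have hg20 : g20 P Q R S = fun x y => Q x y * BB P Q R S x y := by
    ext x y
    simp only [g20, hb1, hb2, hy0]
    ring
  have hg11 : g11 P Q R S = fun x y => 4 * (Q x y * BB P Q R S x y) := by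
    ext x y
    simp only [g11, hb1, hb2, hBx]
    ring
  have hg21 : g21 P Q R S = fun x y => pdy (BB P Q R S) x y + R x y * BB P Q R S x y := by
    ext x y
    simp only [g21, hb1, hb2]
    ring
  intro x y
  have hBxy : pdx (pdy (BB P Q R S)) x y
      = 3 * (pdy Q x y * BB P Q R S x y + Q x y * pdy (BB P Q R S) x y) := by
    rw [← hBs.pdy_pdx, hBx]
    simp only [mul_assoc]
    exact (((hQ.hasDerivAt_pdy_s17 x y).mul (hBs.hasDerivAt_pdy_s17 x y)).const_mul 3).deriv
  have hg10x : pdx (g10 P Q R S) x y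
      = pdx P x y * BB P Q R S x y + P x y * pdx (BB P Q R S) x y := by
    rw [hg10]
    exact ((hP.hasDerivAt_pdx_s17 x y).mul (hBs.hasDerivAt_pdx_s17 x y)).deriv
  have hg20x : pdx (g20 P Q R S) x y
      = pdx Q x y * BB P Q R S x y + Q x y * pdx (BB P Q R S) x y := by
    rw [hg20]
    exact ((hQ.hasDerivAt_pdx_s17 x y).mul (hBs.hasDerivAt_pdx_s17 x y)).deriv
  have hg20y : pdy (g20 P Q R S) x y
      = pdy Q x y * BB P Q R S x y + Q x y * pdy (BB P Q R S) x y := by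
    rw [hg20]
    exact ((hQ.hasDerivAt_pdy_s17 x y).mul (hBs.hasDerivAt_pdy_s17 x y)).deriv
  have hg11x : pdx (g11 P Q R S) x y
      = 4 * (pdx Q x y * BB P Q R S x y + Q x y * pdx (BB P Q R S) x y) := by
    rw [hg11]
    exact (((hQ.hasDerivAt_pdx_s17 x y).mul (hBs.hasDerivAt_pdx_s17 x y)).const_mul 4).deriv
  have hg21x : pdx (g21 P Q R S) x y = pdx (pdy (BB P Q R S)) x y
      + (pdx R x y * BB P Q R S x y + R x y * pdx (BB P Q R S) x y) := by
    rw [hg21]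
    exact ((hBs.uncurry_pdy_s17.hasDerivAt_pdx_s17 x y).add
      ((hR.hasDerivAt_pdx_s17 x y).mul (hBs.hasDerivAt_pdx_s17 x y))).deriv
  have hFx : 5 * F x y ^ 4 * pdx F x y = -(pdx P x y * BB P Q R S x y ^ 3
      + P x y * (3 * BB P Q R S x y ^ 2 * pdx (BB P Q R S) x y)) := by
    have h := ((hF.hasDerivAt_pdx_s17 x y).pow 5).unique
      ((((hP.hasDerivAt_pdx_s17 x y).mul ((hBs.hasDerivAt_pdx_s17 x y).pow 3)).neg).congr_of_eventuallyEq
        (.of_forall fun t => hΦ t y))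
    simpa using h
  have hFy : 5 * F x y ^ 4 * pdy F x y = -(pdy P x y * BB P Q R S x y ^ 3
      + P x y * (3 * BB P Q R S x y ^ 2 * pdy (BB P Q R S) x y)) := by
    have h := ((hF.hasDerivAt_pdy_s17 x y).pow 5).unique
      ((((hP.hasDerivAt_pdy_s17 x y).mul ((hBs.hasDerivAt_pdy_s17 x y).pow 3)).neg).congr_of_eventuallyEq
        (.of_forall fun t => hΦ x t))
    simpa using h
  have hB0 := hB x y
  have hF0 := hFne x y
  have hΦ0 := hΦ x y
  simp only [J1, J2, J3, J4, J0, Gam0, Gam1, d10, d20, d30, d11, d21, hg10x, hg20x, hg20y, hg11x,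
    hg21x, hBxy]
  simp only [hg10, hg20, hg11, hg21, hb1, hb2, hBx, al0, al1] at hFx hFy ⊢
  generalize BB P Q R S x y = b, pdy (BB P Q R S) x y = c, F x y = f, pdx F x y = fx,
    pdy F x y = fy, P x y = p at *
  refine ⟨?_, ?_, ?_, ?_⟩
  · field_simp
    linear_combination -(15 * b) * hFy + (42 * c + 27 * b * R x y) * hΦ0
  · field_simp
    linear_combination -(27 * b ^ 3 * (pdx R x y - 2 * pdy Q x y)
      - 27 * S x y * (f ^ 5 - p * b ^ 3)) * hΦ0
  · field_simp
    linear_combination b * hFx - 15 * b * Q x y * hΦ0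
  · field_simp
    linear_combination -(90 * b ^ 4 * p) * hFy + (450 * b * f ^ 4 * fy
      - (261 * c + 216 * b * R x y) * (f ^ 5 - p * b ^ 3)) * hΦ0
end
end
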